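/- Let α be a real number with 3/4 < α ≤ 1 and σ ∈ {−1, +1}. There is an absolute constant C > 0 such that for every N ∈ ℕ and every sequence u : ℤ → ℂ one has |G_N(u)| ≤ C ( ‖Π_N u‖_{L²}⁴ + ‖Π_N u‖_{L²}² ‖Π_N u‖_{FL^{0,1}}² + ‖Π_N u‖_{L²} ‖Π_N u‖_{H^{2−2α}}² ‖Π_N u‖_{FL^{0,1}}³ ). -/

import Mathlib

open scoped BigOperators ENNReal ComplexConjugate Classical
open Filter Set MeasureTheory ComplexConjugate

noncomputable section

/-- `ℝ≥0∞`-valued `H^s` norm of a sequence of Fourier coefficients. -/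
def hsE (s : ℝ) (u : ℤ → ℂ) : ℝ≥0∞ :=
  (∑' n : ℤ, ENNReal.ofReal (1 + |(n : ℝ)| ^ (2 * s)) * (‖u n‖₊ : ℝ≥0∞) ^ 2) ^ ((1:ℝ)/2)

/-- `ℝ≥0∞`-valued `FL^{0,1}` norm. -/
def flE (u : ℤ → ℂ) : ℝ≥0∞ := ∑' n : ℤ, (‖u n‖₊ : ℝ≥0∞)

/-- real-valued `H^s` norm. -/
def hsR (s : ℝ) (u : ℤ → ℂ) : ℝ :=
  Real.sqrt (∑' n : ℤ, (1 + |(n : ℝ)| ^ (2 * s)) * ‖u n‖ ^ 2)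

/-- real-valued `FL^{0,1}` norm. -/
def flR (u : ℤ → ℂ) : ℝ := ∑' n : ℤ, ‖u n‖

/-- The condition `|j| ≤ N` for `N ∈ ℕ ∪ {∞}`. -/
def inBall (N : ℕ∞) (j : ℤ) : Prop := (j.natAbs : ℕ∞) ≤ N

/-- The resonance function `Φ_α`. -/
def res (α : ℝ) (j₁ j₂ j₃ : ℤ) : ℝ :=
  |(j₁ : ℝ)| ^ (2 * α) + |(j₂ : ℝ)| ^ (2 * α) - |(j₃ : ℝ)| ^ (2 * α)
    - |((j₁ + j₂ - j₃ : ℤ) : ℝ)| ^ (2 * α)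

/-- The (truncated) Birkhoff vector field `X_N`. -/
def XB (α σ : ℝ) (N : ℕ∞) (u : ℤ → ℂ) : ℤ → ℂ := fun n =>
  if inBall N n then
    ∑' p : ℤ × ℤ,
      (if inBall N p.1 ∧ inBall N p.2 ∧ inBall N (p.1 + p.2 - n) ∧
          res α p.1 p.2 (p.1 + p.2 - n) ≠ 0 then
        ((-σ / res α p.1 p.2 (p.1 + p.2 - n) : ℝ) : ℂ) *
          (u p.1 * u p.2 * conj (u (p.1 + p.2 - n)))
      else 0)
  else 0

/-- Truncation `Π_N`. -/
def trunc (N : ℕ) (u : ℤ → ℂ) : ℤ → ℂ := fun n => if n.natAbs ≤ N then u n else 0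

/-- Derivative of a curve at `t`, in the `H^s` norm. -/
def HasHsDerivAt (s : ℝ) (u : ℝ → ℤ → ℂ) (d : ℤ → ℂ) (t : ℝ) : Prop :=
  Tendsto (fun h : ℝ => hsE s (fun n => (u (t + h) n - u t n) / (h : ℂ) - d n))
    (nhdsWithin 0 {(0 : ℝ)}ᶜ) (nhds 0)

/-- Derivative of a curve at `t` within a set `A` of times, in the `H^s` norm. -/
def HasHsDerivWithinAt (s : ℝ) (u : ℝ → ℤ → ℂ) (d : ℤ → ℂ) (A : Set ℝ) (t : ℝ) : Prop :=
  Tendsto (fun h : ℝ => hsE s (fun n => (u (t + h) n - u t n) / (h : ℂ) - d n))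
    (nhdsWithin 0 {h : ℝ | t + h ∈ A ∧ h ≠ 0}) (nhds 0)

/-- Continuity of a curve in the `H^s` norm. -/
def ContHs (s : ℝ) (D : ℝ → ℤ → ℂ) : Prop :=
  ∀ t : ℝ, Tendsto (fun t' => hsE s (fun n => D t' n - D t n)) (nhds t) (nhds 0)

/-- Continuity of a curve in the `H^s` norm, on a set of times. -/
def ContHsOn (s : ℝ) (A : Set ℝ) (D : ℝ → ℤ → ℂ) : Prop :=
  ∀ t ∈ A, Tendsto (fun t' => hsE s (fun n => D t' n - D t n)) (nhdsWithin t A) (nhds 0)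

/-- `u` is a global-in-time solution of `d/dt u = X_N(u)`, as a curve in `H^s`. -/
def IsSol (α σ : ℝ) (N : ℕ∞) (s : ℝ) (u : ℝ → ℤ → ℂ) : Prop :=
  ∀ t : ℝ, hsE s (u t) ≠ ⊤ ∧ HasHsDerivAt s u (XB α σ N (u t)) t

/-- `u` solves `d/dt u = X_N(u)` on the set of times `A`, as a curve in `H^s`. -/
def IsSolOn (α σ : ℝ) (N : ℕ∞) (s : ℝ) (A : Set ℝ) (u : ℝ → ℤ → ℂ) : Prop :=
  ∀ t ∈ A, hsE s (u t) ≠ ⊤ ∧ HasHsDerivWithinAt s u (XB α σ N (u t)) A t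

/-- `u` is a global-in-time continuously differentiable solution, as a curve in `H^s`. -/
def IsC1Sol (α σ : ℝ) (N : ℕ∞) (s : ℝ) (u : ℝ → ℤ → ℂ) : Prop :=
  IsSol α σ N s u ∧ ContHs s (fun t => XB α σ N (u t))

/-- `u` is a continuously differentiable solution on the set of times `A`. -/
def IsC1SolOn (α σ : ℝ) (N : ℕ∞) (s : ℝ) (A : Set ℝ) (u : ℝ → ℤ → ℂ) : Prop :=
  IsSolOn α σ N s A u ∧ ContHsOn s A (fun t => XB α σ N (u t))

/-- integer modes in `[-N, N]`. -/
def Ifin (N : ℕ) : Finset ℤ := Finset.Icc (-(N:ℤ)) (N:ℤ)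

/-- The quartic form `‖Π_N u‖⁴_{L⁴}`. -/
def qL4 (N : ℕ) (u : ℤ → ℂ) : ℝ :=
  (∑ j₁ ∈ Ifin N, ∑ j₂ ∈ Ifin N, ∑ j₃ ∈ Ifin N, ∑ j₄ ∈ Ifin N,
    if j₁ + j₂ = j₃ + j₄ then u j₁ * u j₂ * conj (u j₃) * conj (u j₄) else 0).re

/-- `G_N(u)`, the derivative at `t = 0` of the energy along the truncated Birkhoff flow. -/
def GN (α σ : ℝ) (N : ℕ) (u : ℤ → ℂ) : ℝ :=
  -(σ/2) * qL4 N u + σ * (∑ j ∈ Ifin N, ‖u j‖^2)^2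
  + 2 * σ * (∑ n₁ ∈ Ifin N, ∑ n₂ ∈ Ifin N, ∑ m₁ ∈ Ifin N, ∑ m₂ ∈ Ifin N,
      if n₁ + n₂ = m₁ + m₂ then
        XB α σ (N : ℕ∞) (trunc N u) n₁ * u n₂ * conj (u m₁) * conj (u m₂)
      else 0).re

/-- Convexity of `x ↦ |x| ^ β - M ^ (β - 2) * x ^ 2 / 4` on `[-M, M]`, uniformly in
`β ∈ [3/2, 2]`. -/
lemma convexOn_abs_rpow_sub_sq {β M : ℝ} (hβ : 3 / 2 ≤ β) (hβ' : β ≤ 2) (hM : 0 < M) :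
    ConvexOn ℝ (Icc (-M) M) (fun x : ℝ => |x| ^ β - M ^ (β - 2) / 4 * x ^ 2) := by
  set κ : ℝ := M ^ (β - 2) / 4 with hκ
  have hκ0 : 0 < κ := by positivity
  have key : ∀ t ∈ Ioo 0 M, 4 * κ ≤ t ^ (β - 2) := fun t ht => by
    have := Real.rpow_le_rpow_of_nonpos ht.1 ht.2.le (by linarith : β - 2 ≤ 0)
    rw [hκ]; linarith
  have hcont : ContinuousOn (fun t : ℝ => t ^ β - κ * t ^ 2) (Icc 0 M) :=
    ((Real.continuous_rpow_const (by linarith)).sub (by fun_prop)).continuousOn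
  have hd1 : ∀ t : ℝ, 0 < t →
      HasDerivAt (fun t : ℝ => t ^ β - κ * t ^ 2) (β * t ^ (β - 1) - κ * (2 * t)) t :=
    fun t ht => by
      have h1 := Real.hasDerivAt_rpow_const (x := t) (p := β) (Or.inl ht.ne')
      have h2 := (hasDerivAt_pow 2 t).const_mul κ
      exact (h1.sub h2).congr_deriv (by simp)
  have hd2 : ∀ t : ℝ, 0 < t →
      HasDerivAt (fun t : ℝ => β * t ^ (β - 1) - κ * (2 * t))
        (β * ((β - 1) * t ^ (β - 2)) - κ * 2) t :=
    fun t ht => by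
      have h1 := (Real.hasDerivAt_rpow_const (x := t) (p := β - 1) (Or.inl ht.ne')).const_mul β
      have h2 := ((hasDerivAt_id t).const_mul 2).const_mul κ
      exact (h1.sub h2).congr_deriv (by rw [show β - 1 - 1 = β - 2 by ring]; simp)
  have hconv : ConvexOn ℝ (Icc 0 M) (fun t : ℝ => t ^ β - κ * t ^ 2) := by
    refine convexOn_of_hasDerivWithinAt2_nonneg (convex_Icc 0 M) hcont
      (f' := fun t => β * t ^ (β - 1) - κ * (2 * t))
      (f'' := fun t => β * ((β - 1) * t ^ (β - 2)) - κ * 2) ?_ ?_ ?_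
    · intro t ht
      rw [interior_Icc] at ht
      exact (hd1 t ht.1).hasDerivWithinAt
    · intro t ht
      rw [interior_Icc] at ht
      exact (hd2 t ht.1).hasDerivWithinAt
    · intro t ht
      rw [interior_Icc] at ht
      have h1 := key t ht
      have h2 : 3 / 4 ≤ β * (β - 1) := by nlinarith
      nlinarith
  have hmono : MonotoneOn (fun t : ℝ => t ^ β - κ * t ^ 2) (Icc 0 M) := by
    refine monotoneOn_of_hasDerivWithinAt_nonneg (convex_Icc 0 M) hcont
      (f' := fun t => β * t ^ (β - 1) - κ * (2 * t)) ?_ ?_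
    · intro t ht
      rw [interior_Icc] at ht
      exact (hd1 t ht.1).hasDerivWithinAt
    · intro t ht
      rw [interior_Icc] at ht
      have h1 := key t ht
      have h2 : t ^ (β - 1) = t ^ (β - 2) * t := by
        rw [← Real.rpow_add_one ht.1.ne']; ring_nf
      have h3 : 0 ≤ β * t ^ (β - 2) - 2 * κ := by nlinarith
      have h4 := mul_nonneg h3 ht.1.le
      rw [h2]; linarith
  have himg : (fun x : ℝ => |x|) '' Icc (-M) M ⊆ Icc 0 M := by
    rintro _ ⟨x, hx, rfl⟩
    exact ⟨abs_nonneg x, abs_le.2 hx⟩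
  refine ⟨convex_Icc _ _, fun x hx y hy a b ha hb hab => ?_⟩
  have hx' := himg ⟨x, hx, rfl⟩
  have hy' := himg ⟨y, hy, rfl⟩
  have h1 := hconv.2 hx' hy' ha hb hab
  have h2 : |a • x + b • y| ≤ a • |x| + b • |y| := by
    refine (abs_add_le _ _).trans (le_of_eq ?_)
    simp [abs_mul, abs_of_nonneg ha, abs_of_nonneg hb]
  have h3 := hmono (himg ⟨_, convex_Icc _ _ hx hy ha hb hab, rfl⟩)
    (convex_Icc _ _ hx' hy' ha hb hab) h2
  have h4 := h3.trans h1
  simpa only [sq_abs] using h4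

/-- A convex function takes a smaller sum at an inner pair than at an outer pair of points with
the same sum. -/
lemma ConvexOn.add_le_add_of_between {s : Set ℝ} {F : ℝ → ℝ} (hF : ConvexOn ℝ s F)
    {a b x y : ℝ} (ha : a ∈ s) (hb : b ∈ s) (hxy : x + y = a + b)
    (hx : (x - a) * (x - b) ≤ 0) : F x + F y ≤ F a + F b := by
  wlog hab : a ≤ b generalizing a b
  · rw [add_comm (F a)]
    exact this hb ha (by linarith) (by linarith) (by linarith)
  rcases hab.eq_or_lt with rfl | hlt
  · have : x = a := by nlinarith [sq_nonneg (x - a)]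
    subst this
    have : y = x := by linarith
    rw [this]
  have hax : a ≤ x := by by_contra! h; nlinarith
  have hxb : x ≤ b := by by_contra! h; nlinarith
  have hd : 0 < b - a := by linarith
  set l := (x - a) / (b - a) with hl
  have hl0 : 0 ≤ l := div_nonneg (by linarith) hd.le
  have hl1 : 0 ≤ 1 - l := by
    rw [hl, sub_nonneg, div_le_one hd]; linarith
  have hlx : l * (b - a) = x - a := by rw [hl]; field_simp
  have h1 := hF.2 ha hb hl1 hl0 (by ring)
  have h2 := hF.2 ha hb hl0 hl1 (by ring)
  simp only [smul_eq_mul] at h1 h2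
  rw [show (1 - l) * a + l * b = x by linarith] at h1
  rw [show l * a + (1 - l) * b = y by linarith] at h2
  linarith

/-- Lower bound for the resonance function. -/
lemma le_abs_res {α M : ℝ} (hα : 3 / 4 < α) (hα' : α ≤ 1) (hM : 0 < M) {j₁ j₂ j₃ : ℤ}
    (h₁ : |(j₁ : ℝ)| ≤ M) (h₂ : |(j₂ : ℝ)| ≤ M) (h₃ : |(j₃ : ℝ)| ≤ M)
    (h₄ : |((j₁ + j₂ - j₃ : ℤ) : ℝ)| ≤ M) :
    M ^ (2 * α - 2) / 2 * (|(j₃ : ℝ) - j₁| * |(j₃ : ℝ) - j₂|) ≤ |res α j₁ j₂ j₃| := by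
  have hF := convexOn_abs_rpow_sub_sq (β := 2 * α) (by linarith) (by linarith) hM
  rw [← abs_mul]
  unfold res
  have e₄ : ((j₁ + j₂ - j₃ : ℤ) : ℝ) = j₁ + j₂ - j₃ := by push_cast; ring
  rw [e₄] at h₄ ⊢
  rw [abs_le] at h₁ h₂ h₃ h₄
  rcases le_total (((j₃ : ℝ) - j₁) * ((j₃ : ℝ) - j₂)) 0 with h | h
  · have := hF.add_le_add_of_between (x := j₃) (y := j₁ + j₂ - j₃) h₁ h₂ (by ring) h
    rw [abs_of_nonpos h]
    refine le_trans ?_ (le_abs_self _)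
    nlinarith
  · have := hF.add_le_add_of_between (x := j₁) (y := j₂) h₃ h₄ (by ring) (by linarith)
    rw [abs_of_nonneg h]
    refine le_trans ?_ (neg_le_abs _)
    nlinarith

/-- Upper bound for the reciprocal of the resonance function. -/
lemma abs_div_res_le {α σ : ℝ} (hα : 3 / 4 < α) (hα' : α ≤ 1) (hσ : |σ| = 1) {j₁ j₂ j₃ : ℤ}
    (h : res α j₁ j₂ j₃ ≠ 0) :
    |-σ / res α j₁ j₂ j₃| ≤
      2 * (|(j₁ : ℝ)| ^ (2 - 2 * α) * |(j₁ : ℝ) - j₃|⁻¹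
        + |(j₂ : ℝ)| ^ (2 - 2 * α) * |(j₂ : ℝ) - j₃|⁻¹
        + |(j₃ : ℝ)| ^ (2 - 2 * α) * |(j₃ : ℝ) - j₁|⁻¹) := by
  have h31 : j₃ ≠ j₁ := by
    rintro rfl
    apply h
    simp [res]
  have h32 : j₃ ≠ j₂ := by
    rintro rfl
    apply h
    simp [res]
  have one_le : ∀ {a b : ℤ}, a ≠ b → 1 ≤ |(a : ℝ) - b| := fun {a b} hab => by
    exact_mod_cast Int.one_le_abs (sub_ne_zero.2 hab)
  have hx := one_le h31
  have hy := one_le h32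
  set s : ℝ := 2 - 2 * α with hs
  set M : ℝ := |(j₁ : ℝ)| + |(j₂ : ℝ)| + |(j₃ : ℝ)| with hMdef
  have hM : 0 < M := by
    have := abs_sub (j₃ : ℝ) j₁
    have := abs_nonneg (j₂ : ℝ)
    linarith
  have n1 := abs_nonneg (j₁ : ℝ)
  have n2 := abs_nonneg (j₂ : ℝ)
  have n3 := abs_nonneg (j₃ : ℝ)
  have hres := le_abs_res hα hα' hM (j₁ := j₁) (j₂ := j₂) (j₃ := j₃) (by linarith) (by linarith)
    (by linarith) (by
      push_cast
      exact (abs_sub _ _).trans (by linarith [abs_add_le (j₁ : ℝ) j₂]))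
  have hMs : M ^ s ≤ |(j₁ : ℝ)| ^ s + |(j₂ : ℝ)| ^ s + |(j₃ : ℝ)| ^ s := by
    have e1 := Real.rpow_add_le_add_rpow (add_nonneg n1 n2) n3 (p := s) (by linarith)
      (by linarith)
    have e2 := Real.rpow_add_le_add_rpow n1 n2 (p := s) (by linarith) (by linarith)
    linarith
  have hpow : M ^ (2 * α - 2) = (M ^ s)⁻¹ := by
    rw [← Real.rpow_neg hM.le]; congr 1; rw [hs]; ring
  have hMs0 : 0 < M ^ s := Real.rpow_pos_of_pos hM s
  set x := |(j₃ : ℝ) - j₁|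
  set y := |(j₃ : ℝ) - j₂|
  rw [abs_sub_comm (j₁ : ℝ), abs_sub_comm (j₂ : ℝ), abs_div, abs_neg, hσ]
  have hx0 : 0 < x := by linarith
  have hy0 : 0 < y := by linarith
  have step : 1 / |res α j₁ j₂ j₃| ≤ 2 * (M ^ s * (x⁻¹ * y⁻¹)) := by
    rw [hpow] at hres
    refine (one_div_le_one_div_of_le (by positivity) hres).trans (le_of_eq ?_)
    field_simp
  have hxi : x⁻¹ ≤ 1 := inv_le_one_of_one_le₀ hx
  have hyi : y⁻¹ ≤ 1 := inv_le_one_of_one_le₀ hy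
  have hxy1 : x⁻¹ * y⁻¹ ≤ x⁻¹ := mul_le_of_le_one_right (by positivity) hyi
  have hxy2 : x⁻¹ * y⁻¹ ≤ y⁻¹ := mul_le_of_le_one_left (by positivity) hxi
  refine step.trans (mul_le_mul_of_nonneg_left ?_ zero_le_two)
  calc M ^ s * (x⁻¹ * y⁻¹)
      ≤ (|(j₁ : ℝ)| ^ s + |(j₂ : ℝ)| ^ s + |(j₃ : ℝ)| ^ s) * (x⁻¹ * y⁻¹) := by gcongr
    _ = |(j₁ : ℝ)| ^ s * (x⁻¹ * y⁻¹) + |(j₂ : ℝ)| ^ s * (x⁻¹ * y⁻¹)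
        + |(j₃ : ℝ)| ^ s * (x⁻¹ * y⁻¹) := by ring
    _ ≤ _ := by gcongr

lemma mem_Ifin {N : ℕ} {j : ℤ} : j ∈ Ifin N ↔ j.natAbs ≤ N := by
  simp only [Ifin, Finset.mem_Icc]; omega

lemma inBall_natCast {N : ℕ} {j : ℤ} : inBall (N : ℕ∞) j ↔ j ∈ Ifin N := by
  rw [mem_Ifin, inBall, Nat.cast_le]

lemma trunc_of_mem {N : ℕ} (u : ℤ → ℂ) {j : ℤ} (hj : j ∈ Ifin N) : trunc N u j = u j :=
  if_pos (mem_Ifin.1 hj)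

lemma trunc_of_notMem {N : ℕ} (u : ℤ → ℂ) {j : ℤ} (hj : j ∉ Ifin N) : trunc N u j = 0 :=
  if_neg (mt mem_Ifin.2 hj)

lemma flR_trunc (N : ℕ) (u : ℤ → ℂ) : flR (trunc N u) = ∑ j ∈ Ifin N, ‖u j‖ := by
  rw [flR, tsum_eq_sum (s := Ifin N) fun j hj => by rw [trunc_of_notMem u hj, norm_zero]]
  exact Finset.sum_congr rfl fun j hj => by rw [trunc_of_mem u hj]

lemma hsR_trunc (s : ℝ) (N : ℕ) (u : ℤ → ℂ) :
    hsR s (trunc N u) = √(∑ j ∈ Ifin N, (1 + |(j : ℝ)| ^ (2 * s)) * ‖u j‖ ^ 2) := by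
  rw [hsR, tsum_eq_sum (s := Ifin N) fun j hj => by rw [trunc_of_notMem u hj]; simp]
  congr 1
  exact Finset.sum_congr rfl fun j hj => by rw [trunc_of_mem u hj]

/-- The `ℓ²` norm is bounded by every `H^s` norm. -/
lemma sqrt_sum_sq_le_hsR (s : ℝ) (N : ℕ) (u : ℤ → ℂ) :
    √(∑ j ∈ Ifin N, ‖u j‖ ^ 2) ≤ hsR s (trunc N u) := by
  rw [hsR_trunc]
  gcongr with j
  have : 0 ≤ |(j : ℝ)| ^ (2 * s) := by positivity
  nlinarith [sq_nonneg ‖u j‖]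

/-- The homogeneous `H^s` norm is bounded by the inhomogeneous one. -/
lemma sqrt_sum_rpow_mul_sq_le_hsR (s : ℝ) (N : ℕ) (u : ℤ → ℂ) :
    √(∑ j ∈ Ifin N, (|(j : ℝ)| ^ s * ‖u j‖) ^ 2) ≤ hsR s (trunc N u) := by
  rw [hsR_trunc]
  gcongr with j
  have : |(j : ℝ)| ^ (2 * s) = (|(j : ℝ)| ^ s) ^ 2 := by
    rw [mul_comm, Real.rpow_mul (abs_nonneg _), Real.rpow_two]
  rw [this, mul_pow]
  nlinarith [sq_nonneg ‖u j‖]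

lemma sum_mul_inv_abs_sub_le (I : Finset ℤ) (f : ℤ → ℝ) (k : ℤ) :
    ∑ j ∈ I, f j * |(j : ℝ) - k|⁻¹ ≤
      √(∑' n : ℤ, 1 / (n : ℝ) ^ 2) * √(∑ j ∈ I, f j ^ 2) := by
  have hs : Summable fun n : ℤ => 1 / (n : ℝ) ^ 2 := Real.summable_one_div_int_pow.2 one_lt_two
  have hK : ∑ j ∈ I, (|(j : ℝ) - k|⁻¹) ^ 2 ≤ ∑' n : ℤ, 1 / (n : ℝ) ^ 2 := by
    have he : ∑ j ∈ I, (|(j : ℝ) - k|⁻¹) ^ 2 =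
        ∑ n ∈ I.map (Equiv.subRight k).toEmbedding, 1 / (n : ℝ) ^ 2 := by
      rw [Finset.sum_map]
      refine Finset.sum_congr rfl fun j _ => ?_
      rw [Equiv.coe_toEmbedding, Equiv.subRight_apply, Int.cast_sub, inv_pow, sq_abs, one_div]
    rw [he]
    exact hs.sum_le_tsum _ fun n _ => div_nonneg zero_le_one (sq_nonneg _)
  refine (Real.sum_mul_le_sqrt_mul_sqrt _ _ _).trans ?_
  rw [mul_comm]
  exact mul_le_mul_of_nonneg_right (Real.sqrt_le_sqrt hK) (Real.sqrt_nonneg _)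

lemma sum_ite_add_eq_add_le (I : Finset ℤ) {a : ℤ → ℝ} (ha : ∀ j, 0 ≤ a j) (n : ℤ) :
    ∑ n₂ ∈ I, ∑ m₁ ∈ I, ∑ m₂ ∈ I, (if n + n₂ = m₁ + m₂ then a n₂ * a m₁ * a m₂ else 0) ≤
      (∑ j ∈ I, a j) * ∑ j ∈ I, a j ^ 2 := by
  have aux : ∀ (c : ℤ) (X : ℝ), 0 ≤ X → ∑ m ∈ I, (if m = c then X else 0) ≤ X := by
    intro c X hX
    rw [Finset.sum_ite_eq']
    split_ifs <;> simp [hX]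
  have h1 : ∑ n₂ ∈ I, ∑ m₁ ∈ I, ∑ m₂ ∈ I,
      (if m₂ = n + n₂ - m₁ then a m₁ * a n₂ ^ 2 else 0) ≤
      (∑ j ∈ I, a j) * ∑ j ∈ I, a j ^ 2 := by
    rw [Finset.sum_mul_sum, Finset.sum_comm]
    refine Finset.sum_le_sum fun m₁ _ => Finset.sum_le_sum fun n₂ _ => aux _ _ ?_
    exact mul_nonneg (ha _) (sq_nonneg _)
  have h2 : ∑ n₂ ∈ I, ∑ m₁ ∈ I, ∑ m₂ ∈ I,
      (if n₂ = m₁ + m₂ - n then a m₁ * a m₂ ^ 2 else 0) ≤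
      (∑ j ∈ I, a j) * ∑ j ∈ I, a j ^ 2 := by
    rw [Finset.sum_mul_sum, Finset.sum_comm]
    refine Finset.sum_le_sum fun m₁ _ => ?_
    rw [Finset.sum_comm]
    refine Finset.sum_le_sum fun m₂ _ => aux _ _ ?_
    exact mul_nonneg (ha _) (sq_nonneg _)
  have h3 : ∑ n₂ ∈ I, ∑ m₁ ∈ I, ∑ m₂ ∈ I,
      (if n + n₂ = m₁ + m₂ then a n₂ * a m₁ * a m₂ else 0) ≤
      ∑ n₂ ∈ I, ∑ m₁ ∈ I, ∑ m₂ ∈ I,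
        ((if m₂ = n + n₂ - m₁ then a m₁ * a n₂ ^ 2 else 0) / 2
          + (if n₂ = m₁ + m₂ - n then a m₁ * a m₂ ^ 2 else 0) / 2) := by
    refine Finset.sum_le_sum fun n₂ _ => Finset.sum_le_sum fun m₁ _ =>
      Finset.sum_le_sum fun m₂ _ => ?_
    by_cases h : n + n₂ = m₁ + m₂
    · rw [if_pos h, if_pos (by omega), if_pos (by omega)]
      nlinarith [mul_nonneg (ha m₁) (sq_nonneg (a n₂ - a m₂))]
    · rw [if_neg h, if_neg (by omega), if_neg (by omega)]
      simp
  refine h3.trans ?_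
  simp only [Finset.sum_add_distrib, ← Finset.sum_div]
  linarith

/-- Quadrilinear estimate on the hyperplane `n₁ + n₂ = m₁ + m₂`. -/
lemma abs_re_sum_le (I : Finset ℤ) (w u : ℤ → ℂ) :
    |(∑ n₁ ∈ I, ∑ n₂ ∈ I, ∑ m₁ ∈ I, ∑ m₂ ∈ I,
      if n₁ + n₂ = m₁ + m₂ then w n₁ * u n₂ * conj (u m₁) * conj (u m₂) else 0).re| ≤
      (∑ j ∈ I, ‖w j‖) * ((∑ j ∈ I, ‖u j‖) * ∑ j ∈ I, ‖u j‖ ^ 2) := by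
  refine (Complex.abs_re_le_norm _).trans ?_
  rw [Finset.sum_mul]
  refine norm_sum_le_of_le _ fun n₁ _ => ?_
  refine le_trans ?_ (mul_le_mul_of_nonneg_left
    (sum_ite_add_eq_add_le I (a := fun j => ‖u j‖) (fun _ => norm_nonneg _) n₁) (norm_nonneg _))
  simp only [Finset.mul_sum]
  refine norm_sum_le_of_le _ fun n₂ _ => norm_sum_le_of_le _ fun m₁ _ =>
    norm_sum_le_of_le _ fun m₂ _ => ?_
  split_ifs
  · simp only [norm_mul, RCLike.norm_conj]
    exact le_of_eq (by ring)
  · simp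

lemma sum_ite_sub_mem_le (I : Finset ℤ) {g : ℤ → ℝ} (hg : ∀ j, 0 ≤ g j) (k : ℤ) :
    ∑ n ∈ I, (if k - n ∈ I then g (k - n) else 0) ≤ ∑ j ∈ I, g j := by
  rw [← Finset.sum_filter]
  have hinj : Set.InjOn (fun n => k - n) ((I.filter fun n => k - n ∈ I : Finset ℤ) : Set ℤ) :=
    fun x _ y _ h => by simpa using h
  rw [← Finset.sum_image (f := g) hinj]
  refine Finset.sum_le_sum_of_subset_of_nonneg ?_ fun _ _ _ => hg _
  intro j hj
  obtain ⟨n, hn, rfl⟩ := Finset.mem_image.1 hj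
  exact (Finset.mem_filter.1 hn).2

/-- `ℓ¹` bound for the truncated Birkhoff vector field. -/
lemma sum_norm_XB_le {α σ : ℝ} (hα : 3 / 4 < α) (hα' : α ≤ 1) (hσ : |σ| = 1) (N : ℕ)
    (u : ℤ → ℂ) :
    ∑ n ∈ Ifin N, ‖XB α σ (N : ℕ∞) (trunc N u) n‖ ≤
      6 * √(∑' n : ℤ, 1 / (n : ℝ) ^ 2) * (∑ j ∈ Ifin N, ‖u j‖) ^ 2 *
        √(∑ j ∈ Ifin N, (|(j : ℝ)| ^ (2 - 2 * α) * ‖u j‖) ^ 2) := by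
  set I := Ifin N
  set a : ℤ → ℝ := fun j => ‖u j‖ with ha
  set f : ℤ → ℝ := fun j => |(j : ℝ)| ^ (2 - 2 * α) * ‖u j‖ with hf
  have ha0 : ∀ j, 0 ≤ a j := fun j => norm_nonneg _
  have hf0 : ∀ j, 0 ≤ f j := fun j => by positivity
  set D := √(∑' n : ℤ, 1 / (n : ℝ) ^ 2) * √(∑ j ∈ I, f j ^ 2) with hD
  set A := ∑ j ∈ I, a j with hA
  have hcs : ∀ k : ℤ, ∑ j ∈ I, f j * |(j : ℝ) - k|⁻¹ ≤ D := sum_mul_inv_abs_sub_le I f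
  let g : ℤ → ℤ → ℤ → ℝ := fun j₁ j₂ j₃ =>
    2 * (f j₁ * |(j₁ : ℝ) - j₃|⁻¹ * a j₂ * a j₃ + f j₂ * |(j₂ : ℝ) - j₃|⁻¹ * a j₁ * a j₃
      + f j₃ * |(j₃ : ℝ) - j₁|⁻¹ * a j₁ * a j₂)
  have hg0 : ∀ j₁ j₂ j₃, 0 ≤ g j₁ j₂ j₃ := fun j₁ j₂ j₃ => by
    have := ha0 j₁; have := ha0 j₂; have := ha0 j₃
    have := hf0 j₁; have := hf0 j₂; have := hf0 j₃
    positivity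
  have hXB : ∀ n ∈ I, ‖XB α σ (N : ℕ∞) (trunc N u) n‖ ≤
      ∑ j₁ ∈ I, ∑ j₂ ∈ I, if j₁ + j₂ - n ∈ I then g j₁ j₂ (j₁ + j₂ - n) else 0 := by
    intro n hn
    rw [XB, if_pos (inBall_natCast.2 hn), tsum_eq_sum (s := I ×ˢ I), ← Finset.sum_product']
    · refine norm_sum_le_of_le _ fun p hp => ?_
      obtain ⟨h1, h2⟩ := Finset.mem_product.1 hp
      simp only [inBall_natCast]
      split_ifs with hc h3 h3
      · rw [trunc_of_mem u h1, trunc_of_mem u h2, trunc_of_mem u h3]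
        simp only [norm_mul, RCLike.norm_conj, Complex.norm_real, Real.norm_eq_abs]
        refine (mul_le_mul_of_nonneg_right (abs_div_res_le hα hα' hσ hc.2.2.2)
          (by positivity)).trans (le_of_eq ?_)
        simp only [g, hf, ha]
        ring
      · exact absurd hc.2.2.1 h3
      · simpa using hg0 _ _ _
      · simp
    · intro p hp
      rw [if_neg]
      rintro ⟨h1, h2, -⟩
      exact hp (Finset.mem_product.2 ⟨inBall_natCast.1 h1, inBall_natCast.1 h2⟩)
  have hswap : ∑ n ∈ I, ‖XB α σ (N : ℕ∞) (trunc N u) n‖ ≤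
      ∑ j₁ ∈ I, ∑ j₂ ∈ I, ∑ j₃ ∈ I, g j₁ j₂ j₃ := by
    refine (Finset.sum_le_sum hXB).trans ?_
    rw [Finset.sum_comm]
    refine Finset.sum_le_sum fun j₁ _ => ?_
    rw [Finset.sum_comm]
    exact Finset.sum_le_sum fun j₂ _ => sum_ite_sub_mem_le I (hg0 j₁ j₂) (j₁ + j₂)
  have hbil : ∀ H : ℤ → ℤ → ℤ → ℝ, (∀ k l, ∑ j ∈ I, H k l j ≤ D * (a k * a l)) →
      ∑ k ∈ I, ∑ l ∈ I, ∑ j ∈ I, H k l j ≤ D * A ^ 2 := by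
    intro H hH
    rw [sq, hA, Finset.sum_mul_sum, Finset.mul_sum]
    refine Finset.sum_le_sum fun k _ => ?_
    rw [Finset.mul_sum]
    exact Finset.sum_le_sum fun l _ => hH k l
  have hone : ∀ k l m : ℤ, ∑ j ∈ I, f j * |(j : ℝ) - m|⁻¹ * a k * a l ≤ D * (a k * a l) := by
    intro k l m
    simp only [mul_assoc _ (a k) (a l)]
    rw [← Finset.sum_mul]
    exact mul_le_mul_of_nonneg_right (hcs m) (mul_nonneg (ha0 k) (ha0 l))
  have t1 : ∑ j₁ ∈ I, ∑ j₂ ∈ I, ∑ j₃ ∈ I, f j₁ * |(j₁ : ℝ) - j₃|⁻¹ * a j₂ * a j₃ ≤ D * A ^ 2 := by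
    rw [Finset.sum_comm]
    refine le_trans (le_of_eq (Finset.sum_congr rfl fun j₂ _ => Finset.sum_comm)) ?_
    exact hbil (fun k l j => f j * |(j : ℝ) - l|⁻¹ * a k * a l) fun k l => hone k l l
  have t2 : ∑ j₁ ∈ I, ∑ j₂ ∈ I, ∑ j₃ ∈ I, f j₂ * |(j₂ : ℝ) - j₃|⁻¹ * a j₁ * a j₃ ≤ D * A ^ 2 := by
    refine le_trans (le_of_eq (Finset.sum_congr rfl fun j₁ _ => Finset.sum_comm)) ?_
    exact hbil (fun k l j => f j * |(j : ℝ) - l|⁻¹ * a k * a l) fun k l => hone k l l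
  have t3 : ∑ j₁ ∈ I, ∑ j₂ ∈ I, ∑ j₃ ∈ I, f j₃ * |(j₃ : ℝ) - j₁|⁻¹ * a j₁ * a j₂ ≤ D * A ^ 2 :=
    hbil (fun k l j => f j * |(j : ℝ) - k|⁻¹ * a k * a l) fun k l => hone k l k
  refine hswap.trans ?_
  simp only [g, ← Finset.mul_sum, Finset.sum_add_distrib]
  calc _ ≤ 2 * (D * A ^ 2 + D * A ^ 2 + D * A ^ 2) := by gcongr
    _ = _ := by rw [hD]; ring

/-- Deterministic bound on `G_N(u)`, the derivative at `t = 0` of the energy along the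
truncated Birkhoff flow. -/
theorem statement_14 :
    ∃ C : ℝ, 0 < C ∧ ∀ α σ : ℝ, 3/4 < α → α ≤ 1 → (σ = 1 ∨ σ = -1) →
      ∀ N : ℕ, ∀ u : ℤ → ℂ,
        |GN α σ N u| ≤ C * (hsR 0 (trunc N u) ^ 4
          + hsR 0 (trunc N u) ^ 2 * flR (trunc N u) ^ 2
          + hsR 0 (trunc N u) * hsR (2 - 2*α) (trunc N u) ^ 2 * flR (trunc N u) ^ 3) := by
  set K : ℝ := √(∑' n : ℤ, 1 / (n : ℝ) ^ 2) with hK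
  have hK0 : 0 ≤ K := Real.sqrt_nonneg _
  refine ⟨12 * K + 1, by positivity, fun α σ hα hα' hσ N u => ?_⟩
  have hσ1 : |σ| = 1 := by rcases hσ with rfl | rfl <;> simp
  have hX := sum_norm_XB_le hα hα' hσ1 N u
  have hB0 := sqrt_sum_sq_le_hsR 0 N u
  have hBs := sqrt_sum_sq_le_hsR (2 - 2 * α) N u
  have hFs := sqrt_sum_rpow_mul_sq_le_hsR (2 - 2 * α) N u
  have hT := abs_re_sum_le (Ifin N) (XB α σ (N : ℕ∞) (trunc N u)) u
  have hQ : |qL4 N u| ≤ _ := abs_re_sum_le (Ifin N) u u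
  have hBsq : ∑ j ∈ Ifin N, ‖u j‖ ^ 2 = √(∑ j ∈ Ifin N, ‖u j‖ ^ 2) ^ 2 :=
    (Real.sq_sqrt (Finset.sum_nonneg fun _ _ => sq_nonneg _)).symm
  rw [flR_trunc]
  unfold GN
  rw [hBsq] at hT hQ ⊢
  have hA0 : 0 ≤ ∑ j ∈ Ifin N, ‖u j‖ := Finset.sum_nonneg fun _ _ => norm_nonneg _
  rw [← hK] at hX
  set A := ∑ j ∈ Ifin N, ‖u j‖
  set B := √(∑ j ∈ Ifin N, ‖u j‖ ^ 2)
  set F := √(∑ j ∈ Ifin N, (|(j : ℝ)| ^ (2 - 2 * α) * ‖u j‖) ^ 2)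
  set S := ∑ n ∈ Ifin N, ‖XB α σ (N : ℕ∞) (trunc N u) n‖
  set L := hsR 0 (trunc N u)
  set H := hsR (2 - 2 * α) (trunc N u)
  have hB : 0 ≤ B := Real.sqrt_nonneg _
  have hF : 0 ≤ F := Real.sqrt_nonneg _
  have hL : 0 ≤ L := hB.trans hB0
  have hH : 0 ≤ H := hB.trans hBs
  refine (abs_add_le _ _).trans ((add_le_add_left (abs_add_le _ _) _).trans ?_)
  simp only [abs_mul, abs_neg, abs_div, hσ1, abs_two]
  have e1 : A * (A * B ^ 2) ≤ L ^ 2 * A ^ 2 := by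
    calc A * (A * B ^ 2) = B ^ 2 * A ^ 2 := by ring
      _ ≤ _ := by gcongr
  have e2 : (B ^ 2) ^ 2 ≤ L ^ 4 := by
    rw [← pow_mul]
    gcongr
  have e3 : S * (A * B ^ 2) ≤ 6 * K * (L * H ^ 2 * A ^ 3) := by
    calc S * (A * B ^ 2) ≤ (6 * K * A ^ 2 * F) * (A * B ^ 2) := by gcongr
      _ = 6 * K * (B * (B * F) * A ^ 3) := by ring
      _ ≤ 6 * K * (L * (H * H) * A ^ 3) := by gcongr
      _ = _ := by ring
  have p1 : 0 ≤ L ^ 2 * A ^ 2 := by positivity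
  have p2 : 0 ≤ L ^ 4 := by positivity
  have p3 : 0 ≤ L * H ^ 2 * A ^ 3 := by positivity
  have q1 := mul_nonneg hK0 p1
  have q2 := mul_nonneg hK0 p2
  rw [abs_of_nonneg (by positivity : 0 ≤ (B ^ 2) ^ 2)]
  nlinarith

end
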